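/- arXiv:2110.02540 — 4 statements merged into one kernel-verified Lean document; each statement's English description precedes it below -/
import Mathlib

section
/- Let Φ be a real N×K matrix, let M ≥ K, let s : Fin M → Fin N be an injective map (representing a sampling set S of size M), and let μ > 0. Write Φ_S for the M×K matrix whose rows are the rows of Φ indexed by s (i.e., Φ_S = Φ.submatrix s id), and write (Φ Φᵀ + μI)_S for the M×M principal submatrix of Φ Φᵀ + μ I_N with rows and columns indexed by s. If rank(Φ_S) = K, then Tr[((Φ Φᵀ + μI)_S)⁻¹] = (M − K)/μ + Tr[(Φ_Sᵀ Φ_S + μ I_K)⁻¹]. -/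
open Matrix

/-- A real matrix of the form `B Bᵀ + μ I` with `μ > 0` is invertible. -/
theorem isUnit_det_mul_transpose_add_smul_one {m n : Type*} [Fintype m] [Fintype n]
    [DecidableEq m] (B : Matrix m n ℝ) {μ : ℝ} (hμ : 0 < μ) :
    IsUnit (B * Bᵀ + μ • (1 : Matrix m m ℝ)).det := by
  have hB : (B * Bᵀ).PosSemidef := by
    simpa using Matrix.posSemidef_self_mul_conjTranspose B
  exact (Matrix.PosDef.posSemidef_add hB (Matrix.PosDef.one.smul hμ)).det_pos.ne'.isUnit

/-- The resolvents of `B Bᵀ` and `Bᵀ B` have traces differing by the difference of the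
dimensions divided by the shift. -/
theorem trace_inv_mul_transpose_add_smul_one {m n : Type*} [Fintype m] [Fintype n]
    [DecidableEq m] [DecidableEq n] (B : Matrix m n ℝ) {μ : ℝ} (hμ : 0 < μ) :
    ((B * Bᵀ + μ • (1 : Matrix m m ℝ))⁻¹).trace
      = ((Fintype.card m : ℝ) - Fintype.card n) / μ
        + ((Bᵀ * B + μ • (1 : Matrix n n ℝ))⁻¹).trace := by
  have hA := isUnit_det_mul_transpose_add_smul_one B hμ
  have hD : IsUnit (Bᵀ * B + μ • (1 : Matrix n n ℝ)).det := by
    simpa using isUnit_det_mul_transpose_add_smul_one Bᵀ hμ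
  have hcomm : (B * Bᵀ + μ • (1 : Matrix m m ℝ)) * B
      = B * (Bᵀ * B + μ • (1 : Matrix n n ℝ)) := by
    simp [Matrix.add_mul, Matrix.mul_add, Matrix.mul_assoc]
  have hA_inv := Matrix.nonsing_inv_mul _ hA
  have hD_inv := Matrix.nonsing_inv_mul _ hD
  have hD_inv_right := Matrix.mul_nonsing_inv _ hD
  set A := B * Bᵀ + μ • (1 : Matrix m m ℝ) with hA_def
  set D := Bᵀ * B + μ • (1 : Matrix n n ℝ) with hD_def
  have hpush : A⁻¹ * B = B * D⁻¹ := by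
    calc A⁻¹ * B = A⁻¹ * (B * (D * D⁻¹)) := by rw [hD_inv_right, Matrix.mul_one]
      _ = A⁻¹ * (A * B) * D⁻¹ := by rw [hcomm]; simp only [Matrix.mul_assoc]
      _ = B * D⁻¹ := by rw [← Matrix.mul_assoc, hA_inv, Matrix.one_mul]
  have htrace : (A⁻¹ * (B * Bᵀ)).trace = (D⁻¹ * (Bᵀ * B)).trace := by
    rw [← Matrix.mul_assoc, hpush, Matrix.mul_assoc, Matrix.trace_mul_comm, Matrix.mul_assoc]
  have hA_trace : (A⁻¹ * (B * Bᵀ)).trace + μ * A⁻¹.trace = Fintype.card m := by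
    have := congrArg Matrix.trace hA_inv
    conv_lhs at this => rw [hA_def, Matrix.mul_add, ← hA_def]
    simpa using this
  have hD_trace : (D⁻¹ * (Bᵀ * B)).trace + μ * D⁻¹.trace = Fintype.card n := by
    have := congrArg Matrix.trace hD_inv
    conv_lhs at this => rw [hD_def, Matrix.mul_add, ← hD_def]
    simpa using this
  field_simp
  linarith

/-- Let `Φ` be a real `N × K` matrix, `M ≥ K`, `s : Fin M → Fin N` injective (a sampling
set of size `M`), and `μ > 0`. If the sampled matrix `Φ_S = Φ.submatrix s id` has full
column rank `K`, then
`Tr[((Φ Φᵀ + μ I_N)_S)⁻¹] = (M − K)/μ + Tr[(Φ_Sᵀ Φ_S + μ I_K)⁻¹]`. -/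
theorem trace_inv_principal_submatrix_eq (N M K : ℕ) (hMK : K ≤ M)
    (Φ : Matrix (Fin N) (Fin K) ℝ) (s : Fin M → Fin N) (hs : Function.Injective s)
    (μ : ℝ) (hμ : 0 < μ) (hrank : (Φ.submatrix s id).rank = K) :
    (((Φ * Φᵀ + μ • (1 : Matrix (Fin N) (Fin N) ℝ)).submatrix s s)⁻¹).trace
      = ((M : ℝ) - (K : ℝ)) / μ
        + (((Φ.submatrix s id)ᵀ * (Φ.submatrix s id)
            + μ • (1 : Matrix (Fin K) (Fin K) ℝ))⁻¹).trace := by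
  have hsub : (Φ * Φᵀ + μ • (1 : Matrix (Fin N) (Fin N) ℝ)).submatrix s s
      = Φ.submatrix s id * (Φ.submatrix s id)ᵀ + μ • (1 : Matrix (Fin M) (Fin M) ℝ) := by
    ext i j
    simp [Matrix.mul_apply, Matrix.one_apply, hs.eq_iff]
  rw [hsub]
  simpa using trace_inv_mul_transpose_add_smul_one (Φ.submatrix s id) hμ
end

section
/- Let A be a real M×K matrix with Aᵀ A invertible, let g ∈ ℝ^K, and let n : Ω → ℝ^M be a random vector on a probability space Ω whose components are integrable and square-integrable and satisfy E[n_i n_j] = σ² if i = j and E[n_i n_j] = 0 if i ≠ j, for some σ ≥ 0. Define the least-squares estimator ĝ(ω) = (Aᵀ A)⁻¹ Aᵀ (A g + n(ω)). Then the expected mean square error satisfies E[‖ĝ − g‖₂²] = σ² · Tr[(Aᵀ A)⁻¹]. -/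
open Matrix MeasureTheory

/-- The expected squared Euclidean norm of a linear image of white noise. -/
theorem integral_sum_sq_mulVec {Ω ι κ : Type*} [MeasurableSpace Ω] {μ : Measure Ω}
    [Fintype ι] [DecidableEq ι] [Fintype κ] (B : Matrix κ ι ℝ) (n : Ω → ι → ℝ) (v : ℝ)
    (hint : ∀ i j, Integrable (fun ω => n ω i * n ω j) μ)
    (hcov : ∀ i j, (∫ ω, n ω i * n ω j ∂μ) = if i = j then v else 0) :
    (∫ ω, ∑ k, (B *ᵥ n ω) k ^ 2 ∂μ) = v * (B * Bᵀ).trace := by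
  have hexpand : ∀ ω, ∑ k, (B *ᵥ n ω) k ^ 2 =
      ∑ k, ∑ i, ∑ j, B k i * B k j * (n ω i * n ω j) := fun ω => by
    simp only [mulVec, dotProduct, sq, Finset.sum_mul_sum, mul_mul_mul_comm]
  have hterm : ∀ k i j, Integrable (fun ω => B k i * B k j * (n ω i * n ω j)) μ :=
    fun k i j => (hint i j).const_mul _
  simp_rw [hexpand]
  rw [integral_finsetSum _ fun k _ => integrable_finsetSum _ fun i _ =>
    integrable_finsetSum _ fun j _ => hterm k i j]
  simp only [trace, diag, mul_apply, transpose_apply, Finset.mul_sum]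
  refine Finset.sum_congr rfl fun k _ => ?_
  rw [integral_finsetSum _ fun i _ => integrable_finsetSum _ fun j _ => hterm k i j]
  refine Finset.sum_congr rfl fun i _ => ?_
  rw [integral_finsetSum _ fun j _ => hterm k i j]
  simp [integral_const_mul, hcov, mul_comm]

/-- Observation model `y = A g + n` with `A` of full column rank (`Aᵀ A` invertible),
`g ∈ ℝ^K` fixed, and noise `n` with uncorrelated components of common variance `σ²`
(`E[nᵢ nⱼ] = σ²` if `i = j` and `0` otherwise). The least-squares estimator
`ĝ(ω) = (Aᵀ A)⁻¹ Aᵀ (A g + n(ω))` satisfies `E[‖ĝ − g‖₂²] = σ² · Tr[(Aᵀ A)⁻¹]`. -/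
theorem lsq_expected_mse {Ω : Type*} [MeasureSpace Ω]
    [IsProbabilityMeasure (volume : Measure Ω)]
    (M K : ℕ) (A : Matrix (Fin M) (Fin K) ℝ) (hinv : IsUnit (Aᵀ * A))
    (g : Fin K → ℝ) (n : Ω → Fin M → ℝ) (σ : ℝ) (hσ : 0 ≤ σ)
    (hint : ∀ i, Integrable (fun ω => n ω i))
    (hint2 : ∀ i j, Integrable (fun ω => n ω i * n ω j))
    (hcov : ∀ i j, (∫ ω, n ω i * n ω j) = if i = j then σ ^ 2 else 0) :
    (∫ ω, ∑ k, (((Aᵀ * A)⁻¹ * Aᵀ).mulVec (A.mulVec g + n ω) k - g k) ^ 2)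
      = σ ^ 2 * ((Aᵀ * A)⁻¹).trace := by
  have hdet : IsUnit (Aᵀ * A).det := (isUnit_iff_isUnit_det _).mp hinv
  have herr : ∀ ω k, (((Aᵀ * A)⁻¹ * Aᵀ) *ᵥ (A *ᵥ g + n ω)) k - g k =
      (((Aᵀ * A)⁻¹ * Aᵀ) *ᵥ n ω) k := fun ω k => by
    rw [mulVec_add, mulVec_mulVec, Matrix.mul_assoc, nonsing_inv_mul _ hdet, one_mulVec,
      Pi.add_apply, add_sub_cancel_left]
  have hgram : (Aᵀ * A)⁻¹ * Aᵀ * ((Aᵀ * A)⁻¹ * Aᵀ)ᵀ = (Aᵀ * A)⁻¹ := by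
    rw [transpose_mul, transpose_transpose, transpose_nonsing_inv, transpose_mul,
      transpose_transpose, ← Matrix.mul_assoc, Matrix.mul_assoc _ Aᵀ A,
      nonsing_inv_mul _ hdet, Matrix.one_mul]
  simp_rw [herr]
  rw [integral_sum_sq_mulVec _ n (σ ^ 2) hint2 hcov, hgram]
end

section
/- Let Q be a real symmetric positive definite n×n matrix, let s : Fin t → Fin n be injective, and let i ∈ Fin n be an index not in the range of s. Let A = Q.submatrix s s, let p ∈ ℝ^t be given by p_k = Q_{s(k), i}, and let h = Q_{ii} − pᵀ A⁻¹ p. Let s' : Fin (t+1) → Fin n be the extension of s sending the last index to i (so s' is injective and its range is range(s) ∪ {i}). Then Tr[(Q.submatrix s' s')⁻¹] = Tr[A⁻¹] + h⁻¹ · ‖A⁻¹ p‖₂² + h⁻¹. -/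
open Matrix

theorem Matrix.trace_fromBlocks_eq_add {R l m : Type*} [AddCommMonoid R] [Fintype l] [Fintype m]
    (A : Matrix l l R) (B : Matrix l m R) (C : Matrix m l R) (D : Matrix m m R) :
    (fromBlocks A B C D).trace = A.trace + D.trace := by
  simp [trace]

/-- Trace of the inverse of a matrix bordered by one row and one column, in terms of the Schur
complement of the upper left block. -/
theorem Matrix.trace_inv_fromBlocks_replicateCol_replicateRow {K m : Type*} [Field K] [Fintype m]
    [DecidableEq m] {A : Matrix m m K} (hA : IsUnit A) (u v : m → K) (d : K)
    (hM : IsUnit (fromBlocks A (replicateCol (Fin 1) u) (replicateRow (Fin 1) v)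
      (of fun _ _ => d))) :
    (fromBlocks A (replicateCol (Fin 1) u) (replicateRow (Fin 1) v) (of fun _ _ => d))⁻¹.trace
      = A⁻¹.trace + (d - v ⬝ᵥ A⁻¹ *ᵥ u)⁻¹ * ((A⁻¹ *ᵥ u) ⬝ᵥ (v ᵥ* A⁻¹))
        + (d - v ⬝ᵥ A⁻¹ *ᵥ u)⁻¹ := by
  have := hA.invertible
  have hS := isUnit_fromBlocks_iff_of_invertible₁₁.mp hM
  have := hM.invertible
  have := hS.invertible
  rw [← invOf_eq_nonsing_inv (fromBlocks _ _ _ _), invOf_fromBlocks₁₁_eq,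
    trace_fromBlocks_eq_add]
  have hSd : of (fun _ _ => d) - replicateRow (Fin 1) v * ⅟A * replicateCol (Fin 1) u
      = diagonal fun _ => d - v ⬝ᵥ A⁻¹ *ᵥ u := by
    ext a b
    rw [Subsingleton.elim a b, Matrix.mul_assoc, invOf_eq_nonsing_inv, diagonal_apply_eq]
    rfl
  have hSinv : ⅟(of (fun _ _ => d) - replicateRow (Fin 1) v * ⅟A * replicateCol (Fin 1) u)
      = (d - v ⬝ᵥ A⁻¹ *ᵥ u)⁻¹ • (1 : Matrix (Fin 1) (Fin 1) K) := by
    rw [invOf_eq_nonsing_inv, hSd, inv_subsingleton, smul_one_eq_diagonal]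
    simp
  have htr : (A⁻¹ * replicateCol (Fin 1) u * (replicateRow (Fin 1) v * A⁻¹)).trace
      = (A⁻¹ *ᵥ u) ⬝ᵥ (v ᵥ* A⁻¹) := by
    rw [← replicateCol_mulVec, ← replicateRow_vecMul]
    simp [trace, dotProduct, mul_apply]
  rw [hSinv]
  simp only [invOf_eq_nonsing_inv, Matrix.mul_smul, Matrix.smul_mul, Matrix.mul_one, trace_add,
    trace_smul, smul_eq_mul, trace_one, Fintype.card_fin, Nat.cast_one, mul_one]
  rw [← htr]
  simp only [Matrix.mul_assoc]

/-- Greedy trace update. Let `Q` be a real symmetric positive definite `n × n` matrix,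
`s : Fin t → Fin n` injective, `i` not in the range of `s`, `A = Q.submatrix s s`,
`p_k = Q_{s(k), i}`, and `h = Q_{ii} − pᵀ A⁻¹ p`. Extending `s` by `i` via
`s' = Fin.snoc s i`, we get
`Tr[(Q_{S ∪ {i}})⁻¹] = Tr[A⁻¹] + h⁻¹ ‖A⁻¹ p‖₂² + h⁻¹`. -/
theorem trace_inv_snoc (n t : ℕ) (Q : Matrix (Fin n) (Fin n) ℝ) (hQ : Q.PosDef)
    (s : Fin t → Fin n) (hs : Function.Injective s) (i : Fin n) (hi : i ∉ Set.range s)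
    (A : Matrix (Fin t) (Fin t) ℝ) (hA : A = Q.submatrix s s)
    (p : Fin t → ℝ) (hp : p = fun k => Q (s k) i)
    (h : ℝ) (hh : h = Q i i - p ⬝ᵥ A⁻¹.mulVec p) :
    ((Q.submatrix (Fin.snoc s i) (Fin.snoc s i))⁻¹).trace
      = (A⁻¹).trace + h⁻¹ * (∑ k, (A⁻¹.mulVec p k) ^ 2) + h⁻¹ := by
  have hs' : Function.Injective (Fin.snoc s i : Fin (t + 1) → Fin n) :=
    Fin.snoc_injective_iff.mpr ⟨hs, hi⟩
  have hAunit : IsUnit A := hA ▸ (hQ.submatrix hs).isUnit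
  have hAT : A⁻¹ᵀ = A⁻¹ := by
    have : A.IsHermitian := hA ▸ hQ.isHermitian.submatrix s
    simpa [IsHermitian, conjTranspose_eq_transpose_of_trivial] using this.inv
  have hblocks : (Q.submatrix (Fin.snoc s i) (Fin.snoc s i)).submatrix
      (finSumFinEquiv : Fin t ⊕ Fin 1 ≃ Fin (t + 1)) finSumFinEquiv
      = fromBlocks A (replicateCol (Fin 1) p) (replicateRow (Fin 1) p) (of fun _ _ => Q i i) := by
    have hlast (b : Fin 1) : (Fin.snoc s i : Fin (t + 1) → Fin n) (Fin.natAdd t b) = i := by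
      rw [Subsingleton.elim b (Fin.last 0)]
      exact Fin.snoc_last (α := fun _ => Fin n) i s
    have hinit (a : Fin t) : (Fin.snoc s i : Fin (t + 1) → Fin n) (Fin.castAdd 1 a) = s a :=
      Fin.snoc_castSucc (α := fun _ => Fin n) i s a
    ext (a | a) (b | b)
    · simp [hinit, hA]
    · simp [hinit, hlast, hp]
    · simpa [hinit, hlast, hp] using hQ.isHermitian.apply (s b) i
    · simp [hlast]
  have hunit := ((hQ.submatrix hs').submatrix
    (finSumFinEquiv : Fin t ⊕ Fin 1 ≃ Fin (t + 1)).injective).isUnit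
  rw [hblocks] at hunit
  have hmain := trace_inv_fromBlocks_replicateCol_replicateRow hAunit p p (Q i i) hunit
  have htrace := (finSumFinEquiv : Fin t ⊕ Fin 1 ≃ Fin (t + 1)).sum_comp
    (Q.submatrix (Fin.snoc s i) (Fin.snoc s i))⁻¹.diag
  rw [← hblocks, inv_submatrix_equiv, ← hh, ← mulVec_transpose, hAT] at hmain
  rw [trace, ← htrace]
  refine hmain.trans ?_
  simp only [dotProduct, sq]
end

section
/- Let Q be a real symmetric positive definite n×n matrix, let s : Fin t → Fin n be injective, and let i*, i ∈ Fin n be two distinct indices, neither in the range of s. Let A = Q.submatrix s s, p ∈ ℝ^t with p_k = Q_{s(k), i}, p* ∈ ℝ^t with p*_k = Q_{s(k), i*}, r = A⁻¹ p, r* = A⁻¹ p*, h* = Q_{i* i*} − (p*)ᵀ r*, and c = Q_{i*, i}. Let s' : Fin (t+1) → Fin n be the extension of s sending the last index to i*, and let A' = Q.submatrix s' s'. Set α = (h*)⁻¹ · (pᵀ r*) and β = (h*)⁻¹ · c. Then the vector A'⁻¹ applied to the (t+1)-vector obtained by appending c to p equals the (t+1)-vector whose first t entries are r + (α − β) r*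 and whose last entry is β − α. -/
open Matrix

/-- Block form of the product of a bordered principal submatrix with an extended vector. -/
lemma submatrix_snoc_mulVec_snoc {R ι : Type*} [CommSemiring R] {t : ℕ} (Q : Matrix ι ι R)
    (s : Fin t → ι) (a : ι) (v : Fin t → R) (x : R) :
    (Q.submatrix (Fin.snoc s a : Fin (t + 1) → ι) (Fin.snoc s a : Fin (t + 1) → ι)).mulVec
        (Fin.snoc v x : Fin (t + 1) → R)
      = (Fin.snoc ((Q.submatrix s s).mulVec v + x • fun k => Q (s k) a)
          ((fun k => Q a (s k)) ⬝ᵥ v + x * Q a a) : Fin (t + 1) → R) := by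
  funext j
  refine Fin.lastCases ?_ (fun k => ?_) j <;>
    simp [mulVec, dotProduct, Fin.sum_univ_castSucc, mul_comm x]

/-- The bilinear form of the inverse of a symmetric matrix is symmetric. -/
lemma dotProduct_inv_mulVec_comm {m R : Type*} [Fintype m] [DecidableEq m] [CommRing R]
    {A : Matrix m m R} (hA : A.IsSymm) (u v : m → R) :
    u ⬝ᵥ A⁻¹.mulVec v = v ⬝ᵥ A⁻¹.mulVec u := by
  have h : A⁻¹ᵀ = A⁻¹ := by rw [transpose_nonsing_inv, hA]
  rw [dotProduct_mulVec, ← mulVec_transpose, h, dotProduct_comm]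

/-- Warm-start recursion for the greedy candidate evaluation. Let `Q` be a real symmetric
positive definite `n × n` matrix, `s : Fin t → Fin n` injective, and `i*, i` two distinct
indices not in the range of `s`. With `A = Q.submatrix s s`, `p_k = Q_{s(k), i}`,
`p*_k = Q_{s(k), i*}`, `r = A⁻¹ p`, `r* = A⁻¹ p*`, `h* = Q_{i*i*} − (p*)ᵀ r*`,
`c = Q_{i*, i}`, `s' = Fin.snoc s i*`, `A' = Q.submatrix s' s'`,
`α = (h*)⁻¹ (pᵀ r*)` and `β = (h*)⁻¹ c`, we have
`A'⁻¹ (snoc p c) = snoc (r + (α − β) r*) (β − α)`. -/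
theorem warm_start_recursion (n t : ℕ) (Q : Matrix (Fin n) (Fin n) ℝ) (hQ : Q.PosDef)
    (s : Fin t → Fin n) (hs : Function.Injective s)
    (istar i : Fin n) (hne : istar ≠ i)
    (histar : istar ∉ Set.range s) (hi : i ∉ Set.range s)
    (A : Matrix (Fin t) (Fin t) ℝ) (hA : A = Q.submatrix s s)
    (p : Fin t → ℝ) (hp : p = fun k => Q (s k) i)
    (pstar : Fin t → ℝ) (hpstar : pstar = fun k => Q (s k) istar)
    (r : Fin t → ℝ) (hr : r = A⁻¹.mulVec p)
    (rstar : Fin t → ℝ) (hrstar : rstar = A⁻¹.mulVec pstar)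
    (hstar : ℝ) (hhstar : hstar = Q istar istar - pstar ⬝ᵥ rstar)
    (c : ℝ) (hc : c = Q istar i)
    (A' : Matrix (Fin (t + 1)) (Fin (t + 1)) ℝ)
    (hA' : A' = Q.submatrix (Fin.snoc s istar) (Fin.snoc s istar))
    (α β : ℝ) (hα : α = hstar⁻¹ * (p ⬝ᵥ rstar)) (hβ : β = hstar⁻¹ * c) :
    A'⁻¹.mulVec (Fin.snoc p c)
      = Fin.snoc (fun k => r k + (α - β) * rstar k) (β - α) := by
  have hsymm : Q.IsSymm := isHermitian_iff_isSymm.1 hQ.isHermitian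
  have hrow : (fun k => Q istar (s k)) = pstar := by
    rw [hpstar]; funext k; exact hsymm.apply _ _
  have hAdet : IsUnit A.det := by
    rw [hA]; exact (isUnit_iff_isUnit_det _).1 (hQ.submatrix hs).isUnit
  have hA'det : IsUnit A'.det := by
    rw [hA']
    exact (isUnit_iff_isUnit_det _).1
      (hQ.submatrix (Fin.snoc_injective_iff.2 ⟨hs, histar⟩)).isUnit
  have hmul (v : Fin t → ℝ) (x : ℝ) : A'.mulVec (Fin.snoc v x : Fin (t + 1) → ℝ)
      = (Fin.snoc (A.mulVec v + x • pstar) (pstar ⬝ᵥ v + x * Q istar istar)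
        : Fin (t + 1) → ℝ) := by
    rw [hA', submatrix_snoc_mulVec_snoc, hrow, hA, hpstar]
  have hAr : A.mulVec r = p := by
    rw [hr, mulVec_mulVec, mul_nonsing_inv _ hAdet, one_mulVec]
  have hArstar : A.mulVec rstar = pstar := by
    rw [hrstar, mulVec_mulVec, mul_nonsing_inv _ hAdet, one_mulVec]
  -- If the Schur complement vanished, `snoc (-rstar) 1` would lie in the kernel of `A'`.
  have hstar_ne : hstar ≠ 0 := by
    intro h0
    have hker : A'.mulVec (Fin.snoc (-rstar) 1 : Fin (t + 1) → ℝ) = 0 := by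
      rw [hmul, mulVec_neg, hArstar, dotProduct_neg]
      funext j
      refine Fin.lastCases ?_ (fun k => ?_) j
      · simp only [Fin.snoc_last, Pi.zero_apply]; linarith
      · simp
    have hzero := eq_zero_of_mulVec_eq_zero hA'det.ne_zero hker
    simpa using congrFun hzero (Fin.last t)
  have hcross : pstar ⬝ᵥ r = p ⬝ᵥ rstar := by
    rw [hr, hrstar]
    exact dotProduct_inv_mulVec_comm (hA ▸ hsymm.submatrix s) pstar p
  have hβα : (β - α) * hstar = c - p ⬝ᵥ rstar := by
    rw [hα, hβ]; field_simp
  have hsol : A'.mulVec (Fin.snoc (r + (α - β) • rstar) (β - α) : Fin (t + 1) → ℝ)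
      = (Fin.snoc p c : Fin (t + 1) → ℝ) := by
    rw [hmul, mulVec_add, mulVec_smul, hAr, hArstar, dotProduct_add, dotProduct_smul, hcross,
      smul_eq_mul]
    congr 1
    · module
    · rw [hhstar] at hβα; linarith
  rw [← hsol, mulVec_mulVec, nonsing_inv_mul _ hA'det, one_mulVec]
  rfl
end
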